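/- (Proposition 2) Let Ω_sys ⊆ V_sys and Ω_app ⊆ V_app be state spaces, Ω_tot a composite state space of Ω_sys and Ω_app, Λ a reversible dynamics on Ω_tot, and ξ a pure state of Ω_app implementing a reversible dynamics α_ξ on Ω_sys through Λ, with α_ξ⁻¹ ⊗ id restricting to an affine bijection of Ω_tot onto itself. Suppose for every pure state ω of Ω_sys there is a pure state ξ'(ω) of Ω_app with Λ(ω ⊗ ξ) = α_ξ(ω) ⊗ ξ'(ω), let K_ξ := {ξ'(ω) : ω pure state of Ω_sys}, and for ξ' ∈ K_ξ let Ω_sys^ext[ξ'|ξ] := {ω pure state of Ω_sys : Λ(ω ⊗ ξ) = α_ξ(ω) ⊗ ξ'}. If K_ξ has at least two elements, then K_ξ is finite and the disjoint decomposition of the pure states of Ω_sys into the classes {Ω_sys^ext[ξ'|ξ]}_{ξ'∈K_ξ} is quasi-classical: there exists an observable {A_{ξ'}}_{ξ'∈K_ξ} on Ω_sys with A_{ξ'}(ω) = δ_{ξ'ξ''} for every ω ∈ Ω_sys^ext[ξ''|ξ]. -/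

import Mathlib

open scoped BigOperators

/-- A state space: a compact convex subset `Ω` of a finite-dimensional real vector space `V`
which spans `V` and whose affine hull does not contain the origin. -/
def IsStateSpace {V : Type*} [NormedAddCommGroup V] [NormedSpace ℝ V] (Ω : Set V) : Prop :=
  IsCompact Ω ∧ Convex ℝ Ω ∧ Submodule.span ℝ Ω = ⊤ ∧ (0 : V) ∉ (affineSpan ℝ Ω : Set V)

/-- An effect on `Ω`: a linear functional taking values in `[0,1]` on `Ω`. -/
def IsEffect {V : Type*} [AddCommGroup V] [Module ℝ V] (Ω : Set V) (e : V →ₗ[ℝ] ℝ) : Prop :=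
  ∀ ω ∈ Ω, e ω ∈ Set.Icc (0 : ℝ) 1

/-- The unit effect on `Ω`: the linear functional equal to `1` on `Ω`. -/
def IsUnitEffect {V : Type*} [AddCommGroup V] [Module ℝ V] (Ω : Set V)
    (u : V →ₗ[ℝ] ℝ) : Prop :=
  ∀ ω ∈ Ω, u ω = 1

/-- An observable on `Ω`: a finite family of effects summing to the unit effect. -/
def IsObservable {V : Type*} [AddCommGroup V] [Module ℝ V] (Ω : Set V) {X : Type*} [Fintype X]
    (e : X → (V →ₗ[ℝ] ℝ)) : Prop :=
  (∀ x, IsEffect Ω (e x)) ∧ ∀ ω ∈ Ω, ∑ x, e x ω = 1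

/-- The fidelity of two states `ω, σ ∈ Ω`: the infimum over all observables `{e_x}` on `Ω`
of `∑ x, √(e_x ω) · √(e_x σ)`. -/
noncomputable def fidelity {V : Type*} [AddCommGroup V] [Module ℝ V] (Ω : Set V)
    (ω σ : V) : ℝ :=
  sInf { r | ∃ (nn : ℕ) (e : Fin nn → (V →ₗ[ℝ] ℝ)), IsObservable Ω e ∧
    r = ∑ x, Real.sqrt (e x ω) * Real.sqrt (e x σ) }

/-- The tensor product of two states, realized in the function space indexed by the
product of the index sets. -/
def tmul {ι₁ ι₂ : Type} (ω : ι₁ → ℝ) (σ : ι₂ → ℝ) : ι₁ × ι₂ → ℝ :=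
  fun p => ω p.1 * σ p.2

/-- Auxiliary: partial application of a functional on the second factor. -/
def curryMap {ι₁ ι₂ : Type} (f : (ι₂ → ℝ) →ₗ[ℝ] ℝ) : (ι₁ × ι₂ → ℝ) →ₗ[ℝ] (ι₁ → ℝ) where
  toFun μ := fun i => f (fun j => μ (i, j))
  map_add' μ ν := by funext i; exact f.map_add _ _
  map_smul' c μ := by funext i; exact f.map_smul c _

/-- The tensor product `e ⊗ f` of two effects, as a linear functional on the
composite space; it satisfies `(e ⊗ f)(ω ⊗ σ) = e ω · f σ`. -/
def etmul {ι₁ ι₂ : Type} (e : (ι₁ → ℝ) →ₗ[ℝ] ℝ) (f : (ι₂ → ℝ) →ₗ[ℝ] ℝ) :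
    (ι₁ × ι₂ → ℝ) →ₗ[ℝ] ℝ :=
  e.comp (curryMap f)

/-- The linear map `β ⊗ id` on the composite space. -/
def lTensorId {ι₁ ι₂ : Type} (β : (ι₁ → ℝ) →ₗ[ℝ] (ι₁ → ℝ)) :
    (ι₁ × ι₂ → ℝ) →ₗ[ℝ] (ι₁ × ι₂ → ℝ) where
  toFun μ := fun p => β (fun i => μ (i, p.2)) p.1
  map_add' μ ν := by funext p; exact congrFun (β.map_add _ _) p.1
  map_smul' c μ := by funext p; exact congrFun (β.map_smul c _) p.1

/-- The minimal tensor product of two state spaces: the convex hull of product states. -/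
def minTensor {ι₁ ι₂ : Type} (Ω₁ : Set (ι₁ → ℝ)) (Ω₂ : Set (ι₂ → ℝ)) :
    Set (ι₁ × ι₂ → ℝ) :=
  convexHull ℝ {μ | ∃ ω ∈ Ω₁, ∃ σ ∈ Ω₂, μ = tmul ω σ}

/-- The maximal tensor product of two state spaces: all `μ` normalized by the unit effects
and giving nonnegative probabilities on all product effects. -/
def maxTensor {ι₁ ι₂ : Type} (Ω₁ : Set (ι₁ → ℝ)) (Ω₂ : Set (ι₂ → ℝ)) :
    Set (ι₁ × ι₂ → ℝ) :=
  {μ | (∀ u₁ u₂, IsUnitEffect Ω₁ u₁ → IsUnitEffect Ω₂ u₂ → etmul u₁ u₂ μ = 1) ∧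
    ∀ e f, IsEffect Ω₁ e → IsEffect Ω₂ f → 0 ≤ etmul e f μ}

/-- A composite state space of `Ω₁` and `Ω₂`: a compact convex set between the minimal
and the maximal tensor products. -/
def IsComposite {ι₁ ι₂ : Type} [Fintype ι₁] [Fintype ι₂] (Ω₁ : Set (ι₁ → ℝ))
    (Ω₂ : Set (ι₂ → ℝ)) (Ωtot : Set (ι₁ × ι₂ → ℝ)) : Prop :=
  IsCompact Ωtot ∧ Convex ℝ Ωtot ∧ minTensor Ω₁ Ω₂ ⊆ Ωtot ∧ Ωtot ⊆ maxTensor Ω₁ Ω₂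

/-- A program `ξ ∈ Ω_app` implements the dynamics `α` on `Ω_sys` through the dynamics `Λ`
on the composite: `(e ⊗ u_app)(Λ(ω ⊗ ξ)) = e(α ω)` for all states `ω` and effects `e`. -/
def Implements {ι₁ ι₂ : Type} (Ωsys : Set (ι₁ → ℝ)) (Ωapp : Set (ι₂ → ℝ))
    (Λ : (ι₁ × ι₂ → ℝ) →ₗ[ℝ] (ι₁ × ι₂ → ℝ)) (ξ : ι₂ → ℝ)
    (α : (ι₁ → ℝ) →ₗ[ℝ] (ι₁ → ℝ)) : Prop :=
  ∀ ω ∈ Ωsys, ∀ e : (ι₁ → ℝ) →ₗ[ℝ] ℝ, IsEffect Ωsys e →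
    ∀ u₂ : (ι₂ → ℝ) →ₗ[ℝ] ℝ, IsUnitEffect Ωapp u₂ →
      etmul e u₂ (Λ (tmul ω ξ)) = e (α ω)

/-- The functions `g` for which the vectors `v ∈ E` are simultaneous eigenvectors, with
eigenvalues `g v`, of some linear endomorphism. -/
def eigenvalueFunctions {V : Type*} [AddCommGroup V] [Module ℝ V] (E : Set V) :
    Subalgebra ℝ (V → ℝ) where
  carrier := {g | ∃ T : V →ₗ[ℝ] V, ∀ v ∈ E, T v = g v • v}
  mul_mem' := by
    rintro g h ⟨S, hS⟩ ⟨T, hT⟩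
    exact ⟨S ∘ₗ T, fun v hv => by simp [hS v hv, hT v hv, smul_smul, mul_comm]⟩
  add_mem' := by
    rintro g h ⟨S, hS⟩ ⟨T, hT⟩
    exact ⟨S + T, fun v hv => by simp [hS v hv, hT v hv, add_smul]⟩
  algebraMap_mem' r := ⟨r • LinearMap.id, fun v _ => by simp⟩

theorem finite_image_of_mem_eigenvalueFunctions {V : Type*} [AddCommGroup V] [Module ℝ V]
    [FiniteDimensional ℝ V] {E : Set V} (hE : (0 : V) ∉ E) {g : V → ℝ}
    (hg : g ∈ eigenvalueFunctions E) : (g '' E).Finite := by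
  obtain ⟨T, hT⟩ := hg
  refine (Module.End.finite_hasEigenvalue T).subset ?_
  rintro _ ⟨v, hv, rfl⟩
  exact Module.End.hasEigenvalue_of_hasEigenvector (x := v)
    ⟨Module.End.mem_eigenspace_iff.2 (hT v hv), fun h => hE (h ▸ hv)⟩

/-- The indicator function of a fibre of a map with finite image, all of whose coordinates are
eigenvalue functions, agrees on `E` with an eigenvalue function. -/
theorem exists_eigenvalueFunction_eq_ite {V ι : Type*} [AddCommGroup V] [Module ℝ V]
    {E : Set V} {φ : V → ι → ℝ} (hφ : ∀ j, (fun v => φ v j) ∈ eigenvalueFunctions E)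
    (hfin : (φ '' E).Finite) (κ : ι → ℝ) [DecidableEq (ι → ℝ)] :
    ∃ g ∈ eigenvalueFunctions E, ∀ v ∈ E, g v = if κ = φ v then 1 else 0 := by
  have hsep : ∀ η : ι → ℝ, η ≠ κ → ∃ g ∈ eigenvalueFunctions E,
      ∀ v, (φ v = κ → g v = 1) ∧ (φ v = η → g v = 0) := by
    intro η hη
    obtain ⟨j, hj⟩ := Function.ne_iff.1 hη
    refine ⟨(κ j - η j)⁻¹ • ((fun v => φ v j) - algebraMap ℝ (V → ℝ) (η j)),
      Subalgebra.smul_mem _ (sub_mem (hφ j) (Subalgebra.algebraMap_mem _ _)) _,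
      fun v => ⟨?_, ?_⟩⟩
    · rintro rfl
      simp [inv_mul_cancel₀ (sub_ne_zero.2 (Ne.symm hj))]
    · rintro rfl
      simp
  choose! s hs hsv using hsep
  refine ⟨∏ η ∈ hfin.toFinset.erase κ, s η,
    prod_mem fun η hη => hs η (Finset.ne_of_mem_erase hη), fun v hv => ?_⟩
  rw [Finset.prod_apply]
  split_ifs with h
  · exact Finset.prod_eq_one fun η hη => (hsv η (Finset.ne_of_mem_erase hη) v).1 h.symm
  · refine Finset.prod_eq_zero (i := φ v) (Finset.mem_erase.2 ⟨Ne.symm h, ?_⟩)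
      ((hsv _ (Ne.symm h) v).2 rfl)
    exact hfin.mem_toFinset.2 ⟨v, hv, rfl⟩

/-- A state space admits a unit effect. -/
theorem IsStateSpace.exists_isUnitEffect {V : Type*} [NormedAddCommGroup V] [NormedSpace ℝ V]
    {Ω : Set V} (h : IsStateSpace Ω) : ∃ u : V →ₗ[ℝ] ℝ, IsUnitEffect Ω u := by
  obtain ⟨-, -, -, h0⟩ := h
  rcases Ω.eq_empty_or_nonempty with rfl | ⟨p, hp⟩
  · exact ⟨0, by simp [IsUnitEffect]⟩
  have hpS : p ∈ affineSpan ℝ Ω := subset_affineSpan ℝ Ω hp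
  have hpD : p ∉ (affineSpan ℝ Ω).direction := fun hpD => by
    have := AffineSubspace.vadd_mem_of_mem_direction (neg_mem hpD) hpS
    exact h0 (by simpa using this)
  obtain ⟨f, hfp, hf⟩ := Submodule.exists_le_ker_of_notMem hpD
  refine ⟨(f p)⁻¹ • f, fun ω hω => ?_⟩
  have : f (ω - p) = 0 :=
    hf (AffineSubspace.vsub_mem_direction (subset_affineSpan ℝ Ω hω) hpS)
  rw [map_sub, sub_eq_zero] at this
  simp [this, hfp]

/-- If a linear functional maps the pure states into a closed convex set, it maps every state
into it. -/
theorem IsStateSpace.mapsTo_of_extremePoints {V : Type*} [NormedAddCommGroup V]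
    [NormedSpace ℝ V] [FiniteDimensional ℝ V] {Ω : Set V} (h : IsStateSpace Ω)
    (e : V →ₗ[ℝ] ℝ) {C : Set ℝ} (hC : IsClosed C) (hC' : Convex ℝ C)
    (he : Set.MapsTo e (Ω.extremePoints ℝ) C) : Set.MapsTo e Ω C := by
  change Ω ⊆ e ⁻¹' C
  rw [← closure_convexHull_extremePoints h.1 h.2.1]
  exact closure_minimal (convexHull_min he (hC'.linear_preimage e))
    (hC.preimage e.continuous_of_finiteDimensional)

/-- Tensoring with a fixed state on the right, as a linear map. -/
def tmulRight {ι₁ ι₂ : Type} (σ : ι₂ → ℝ) : (ι₁ → ℝ) →ₗ[ℝ] (ι₁ × ι₂ → ℝ) where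
  toFun ω := tmul ω σ
  map_add' ω ω' := by funext p; simp [tmul, add_mul]
  map_smul' c ω := by funext p; simp [tmul, mul_assoc]

theorem tmul_left_cancel {ι₁ ι₂ : Type} {ω : ι₁ → ℝ} (hω : ω ≠ 0) {σ τ : ι₂ → ℝ}
    (h : tmul ω σ = tmul ω τ) : σ = τ := by
  obtain ⟨i, hi⟩ := Function.ne_iff.1 hω
  funext j
  exact mul_left_cancel₀ hi (congrFun h (i, j))

/-- Proposition 2: the decomposition of the pure states of the system induced by the
residual apparatus states of a program is finite and quasi-classical. -/
theorem quasiClassical_decomposition {ι₁ ι₂ : Type} [Fintype ι₁] [Fintype ι₂]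
    (Ωsys : Set (ι₁ → ℝ)) (Ωapp : Set (ι₂ → ℝ)) (Ωtot : Set (ι₁ × ι₂ → ℝ))
    (hsys : IsStateSpace Ωsys) (happ : IsStateSpace Ωapp)
    (htot : IsComposite Ωsys Ωapp Ωtot)
    (Λ : (ι₁ × ι₂ → ℝ) →ₗ[ℝ] (ι₁ × ι₂ → ℝ)) (hΛ : Set.BijOn Λ Ωtot Ωtot)
    (ξ : ι₂ → ℝ) (hξ : ξ ∈ Ωapp.extremePoints ℝ)
    (α : (ι₁ → ℝ) →ₗ[ℝ] (ι₁ → ℝ)) (hα : Set.BijOn α Ωsys Ωsys)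
    (himp : Implements Ωsys Ωapp Λ ξ α)
    (hb : ∃ β : (ι₁ → ℝ) →ₗ[ℝ] (ι₁ → ℝ), (∀ v, β (α v) = v) ∧ (∀ v, α (β v) = v) ∧
      Set.BijOn (lTensorId β) Ωtot Ωtot)
    (ξp : (ι₁ → ℝ) → (ι₂ → ℝ))
    (hξp : ∀ ω ∈ Ωsys.extremePoints ℝ,
      ξp ω ∈ Ωapp.extremePoints ℝ ∧ Λ (tmul ω ξ) = tmul (α ω) (ξp ω))
    (K : Set (ι₂ → ℝ)) (hK : K = ξp '' (Ωsys.extremePoints ℝ))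
    (hK2 : K.Nontrivial) :
    ∃ hfin : K.Finite, ∃ A : (ι₂ → ℝ) → ((ι₁ → ℝ) →ₗ[ℝ] ℝ),
      (∀ ξ' ∈ K, IsEffect Ωsys (A ξ')) ∧
      (∀ ω ∈ Ωsys, ∑ ξ' ∈ hfin.toFinset, A ξ' ω = 1) ∧
      ∀ ξ' ∈ K, ∀ ξ'' ∈ K, ∀ ω ∈ Ωsys.extremePoints ℝ,
        Λ (tmul ω ξ) = tmul (α ω) ξ'' → A ξ' ω = if ξ' = ξ'' then 1 else 0 := by
  classical
  obtain ⟨u, hu⟩ := hsys.exists_isUnitEffect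
  have hne : ∀ ω ∈ Ωsys, ω ≠ 0 := by
    rintro _ hω rfl
    simpa using hu 0 hω
  obtain ⟨β, hβα, -, -⟩ := hb
  have hcoord : ∀ j, (fun ω => ξp ω j) ∈ eigenvalueFunctions (Ωsys.extremePoints ℝ) := by
    intro j
    refine ⟨β ∘ₗ LinearMap.funLeft ℝ ℝ (fun i => (i, j)) ∘ₗ Λ ∘ₗ tmulRight ξ, fun ω hω => ?_⟩
    have hΛω : LinearMap.funLeft ℝ ℝ (fun i => (i, j)) (Λ (tmul ω ξ)) = ξp ω j • α ω := by
      rw [(hξp ω hω).2]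
      funext i
      exact mul_comm _ _
    change β (LinearMap.funLeft ℝ ℝ (fun i => (i, j)) (Λ (tmul ω ξ))) = ξp ω j • ω
    rw [hΛω, map_smul, hβα]
  have hfin : K.Finite := by
    refine (Set.Finite.pi' fun j => finite_image_of_mem_eigenvalueFunctions
      (fun h => hne 0 h.1 rfl) (hcoord j)).subset ?_
    rw [hK]
    rintro _ ⟨ω, hω, rfl⟩ j
    exact ⟨ω, hω, rfl⟩
  choose g hg hgv using fun κ => exists_eigenvalueFunction_eq_ite hcoord (hK ▸ hfin) κ
  choose T hT using hg
  have hA : ∀ κ, ∀ ω ∈ Ωsys.extremePoints ℝ, (u ∘ₗ T κ) ω = if κ = ξp ω then 1 else 0 := by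
    intro κ ω hω
    rw [LinearMap.comp_apply, hT κ ω hω, hgv κ ω hω, map_smul, hu ω hω.1, smul_eq_mul, mul_one]
  refine ⟨hfin, fun κ => u ∘ₗ T κ, fun κ _ => ?_, fun ω hω => ?_, ?_⟩
  · refine hsys.mapsTo_of_extremePoints _ isClosed_Icc (convex_Icc 0 1) fun ω hω => ?_
    rw [hA κ ω hω]
    split_ifs <;> simp
  · have hsum := hsys.mapsTo_of_extremePoints (∑ κ ∈ hfin.toFinset, u ∘ₗ T κ)
      (isClosed_singleton (x := 1)) (convex_singleton 1) (fun ω hω => ?_) hω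
    · simpa only [LinearMap.sum_apply, Set.mem_singleton_iff] using hsum
    · have hmem : ξp ω ∈ K := hK ▸ ⟨ω, hω, rfl⟩
      rw [Set.mem_singleton_iff, LinearMap.sum_apply, Finset.sum_congr rfl fun κ _ => hA κ ω hω]
      simp [hmem]
  · intro κ _ η _ ω hω h
    rw [(hξp ω hω).2] at h
    rw [← tmul_left_cancel (hne _ (hα.mapsTo hω.1)) h, hA κ ω hω]
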